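/- arXiv:1707.05439 — 2 statements merged into one kernel-verified Lean document; each statement's English description precedes it below -/
import Mathlib

section
/- Let G be a finite simple graph that is Δ-regular with girth at least 5 and diameter at most 2, and let w be any vertex of G. Then the induced subgraph G' of G on the vertex set V(G) \ ({w} ∪ N(w)) is (Δ − 1)-regular and connected; moreover, any two vertices of G' lie at distance at most 2 in G' whenever they have no common neighbor (in G) inside N(w). -/
namespace SimpleGraph

variable {V : Type*} {G : SimpleGraph V}

lemma not_adj_of_adj_of_adj_of_five_le_girth (hgirth : 5 ≤ G.girth) {a b c : V}
    (hab : G.Adj a b) (hbc : G.Adj b c) : ¬ G.Adj c a := by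
  intro hca
  have hcyc : (Walk.cons hab (Walk.cons hbc (Walk.cons hca Walk.nil))).IsCycle := by
    simp [Walk.cons_isCycle_iff, hab.ne, hbc.ne, hca.ne, hab.ne', hca.ne']
  have := hcyc.girth_le_length
  simp at this
  omega

lemma eq_of_common_neighbors_of_five_le_girth (hgirth : 5 ≤ G.girth) {a b c d : V}
    (hac : a ≠ c) (hab : G.Adj a b) (hbc : G.Adj b c) (had : G.Adj a d) (hdc : G.Adj d c) :
    b = d := by
  by_contra hbd
  have hcyc : (Walk.cons hab (Walk.cons hbc (Walk.cons hdc.symm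
      (Walk.cons had.symm Walk.nil)))).IsCycle := by
    simp [Walk.cons_isCycle_iff, hab.ne, hbc.ne, had.ne, hab.ne', hdc.ne',
      had.ne', hac, hbd, Ne.symm hac]
  have := hcyc.girth_le_length
  simp at this
  omega

lemma adj_or_exists_common_neighbor_of_length_le_two {u v : V} (huv : u ≠ v)
    (p : G.Walk u v) (hp : p.length ≤ 2) : G.Adj u v ∨ ∃ z, G.Adj u z ∧ G.Adj z v := by
  match p with
  | .nil => exact absurd rfl huv
  | .cons h .nil => exact .inl h
  | .cons h (.cons h' .nil) => exact .inr ⟨_, h, h'⟩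
  | .cons h (.cons h' (.cons h'' q)) => simp at hp

lemma IsRegularOfDegree.two_le_of_girth_pos [G.LocallyFinite] {Δ : ℕ}
    (hreg : G.IsRegularOfDegree Δ) (hgirth : 0 < G.girth) : 2 ≤ Δ := by
  have hcyc : ¬ G.IsAcyclic := fun h => hgirth.ne' (girth_eq_zero.2 h)
  obtain ⟨u, p, hp, -⟩ := exists_girth_eq_length.2 hcyc
  have hnil := hp.not_nil
  rw [← hreg u, ← G.card_neighborFinset_eq_degree, ← Nat.lt_iff_add_one_le,
    Finset.one_lt_card]
  exact ⟨p.snd, by simpa using p.adj_snd hnil, p.penultimate,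
    by simpa using (p.adj_penultimate hnil).symm, hp.snd_ne_penultimate⟩

lemma IsRegularOfDegree.exists_adj_ne [G.LocallyFinite] {Δ : ℕ}
    (hreg : G.IsRegularOfDegree Δ) (hΔ : 2 ≤ Δ) (v z : V) : ∃ u, G.Adj v u ∧ u ≠ z := by
  have h : 1 < (G.neighborFinset v).card := by
    rw [G.card_neighborFinset_eq_degree, hreg v]; omega
  obtain ⟨u, hu, huz⟩ := Finset.exists_mem_ne h z
  exact ⟨u, by simpa using hu, huz⟩

end SimpleGraph

/-- Let `G` be a `Δ`-regular graph with girth at least 5 and diameter at most 2, and let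
`w` be a vertex.  The subgraph `G'` induced on the vertices outside the closed neighborhood
of `w` is `(Δ - 1)`-regular (every vertex has exactly `Δ - 1` neighbors inside `G'`) and
connected; moreover any two vertices of `G'` with no common neighbor (in `G`) inside
`N(w)` are joined in `G'` by a path of length at most 2. -/
theorem induced_outside_closed_neighborhood {V : Type*} [Fintype V] [DecidableEq V]
    (G : SimpleGraph V) [DecidableRel G.Adj] (Δ : ℕ)
    (hreg : G.IsRegularOfDegree Δ) (hgirth : 5 ≤ G.girth)
    (hdiam : ∀ u v : V, ∃ p : G.Walk u v, p.length ≤ 2) (w : V) :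
    (∀ v : ({v : V | v ≠ w ∧ ¬ G.Adj w v} : Set V),
        {u : V | (u ≠ w ∧ ¬ G.Adj w u) ∧ G.Adj v.1 u}.ncard = Δ - 1) ∧
    (G.induce {v : V | v ≠ w ∧ ¬ G.Adj w v}).Connected ∧
    (∀ u v : ({v : V | v ≠ w ∧ ¬ G.Adj w v} : Set V),
        (¬ ∃ z : V, G.Adj w z ∧ G.Adj z u.1 ∧ G.Adj z v.1) →
        ∃ p : (G.induce {v : V | v ≠ w ∧ ¬ G.Adj w v}).Walk u v, p.length ≤ 2) := by
  have hΔ : 2 ≤ Δ := hreg.two_le_of_girth_pos (by omega)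
  have htri {a b c : V} (hab : G.Adj a b) (hbc : G.Adj b c) : ¬ G.Adj c a :=
    SimpleGraph.not_adj_of_adj_of_adj_of_five_le_girth hgirth hab hbc
  have huniq {a b c d : V} (hac : a ≠ c) (hab : G.Adj a b) (hbc : G.Adj b c)
      (had : G.Adj a d) (hdc : G.Adj d c) : b = d :=
    SimpleGraph.eq_of_common_neighbors_of_five_le_girth hgirth hac hab hbc had hdc
  have hnear {u v : V} (huv : u ≠ v) : G.Adj u v ∨ ∃ z, G.Adj u z ∧ G.Adj z v := by
    obtain ⟨p, hp⟩ := hdiam u v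
    exact SimpleGraph.adj_or_exists_common_neighbor_of_length_le_two huv p hp
  have hshort : ∀ u v : ({v : V | v ≠ w ∧ ¬ G.Adj w v} : Set V),
      (¬ ∃ z : V, G.Adj w z ∧ G.Adj z u.1 ∧ G.Adj z v.1) →
      ∃ p : (G.induce {v : V | v ≠ w ∧ ¬ G.Adj w v}).Walk u v, p.length ≤ 2 := by
    rintro ⟨u, hu⟩ ⟨v, hv⟩ hz
    by_cases huv : u = v
    · subst huv
      exact ⟨.nil, by simp⟩
    rcases hnear huv with h | ⟨z, huz, hzv⟩
    · exact ⟨.cons (by simpa using h) .nil, by simp⟩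
    · have hzmem : z ∈ {v : V | v ≠ w ∧ ¬ G.Adj w v} :=
        ⟨fun h => hu.2 (h ▸ huz.symm), fun h => hz ⟨z, h, huz.symm, hzv⟩⟩
      exact ⟨.cons (v := ⟨z, hzmem⟩) (by simpa using huz) (.cons (by simpa using hzv) .nil),
        by simp⟩
  refine ⟨?_, ?_, hshort⟩
  · rintro ⟨v, hvw, hv⟩
    obtain ⟨z, hwz, hzv⟩ := (hnear hvw.symm).resolve_left hv
    have hset : {u : V | (u ≠ w ∧ ¬ G.Adj w u) ∧ G.Adj v u} =
        ((G.neighborFinset v).erase z : Finset V) := by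
      ext u
      simp only [Set.mem_ofPred_eq, Finset.coe_erase, Set.mem_sdiff, Finset.mem_coe,
        SimpleGraph.mem_neighborFinset, Set.mem_singleton_iff]
      constructor
      · rintro ⟨⟨-, hwu⟩, hvu⟩
        exact ⟨hvu, fun h => hwu (h ▸ hwz)⟩
      · rintro ⟨hvu, huz⟩
        exact ⟨⟨fun h => hv (h ▸ hvu).symm, fun h => huz (huniq hvw.symm h hvu.symm hwz hzv)⟩,
          hvu⟩
    rw [hset, Set.ncard_coe_finset, Finset.card_erase_of_mem (by simpa using hzv.symm),
      G.card_neighborFinset_eq_degree, hreg v]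
  · obtain ⟨a, hwa, -⟩ := hreg.exists_adj_ne hΔ w w
    obtain ⟨b, hab, hbw⟩ := hreg.exists_adj_ne hΔ a w
    have hne : Nonempty ({v : V | v ≠ w ∧ ¬ G.Adj w v} : Set V) :=
      ⟨⟨b, hbw, fun h => htri hwa hab h.symm⟩⟩
    refine ⟨fun u v => ?_⟩
    by_cases hz : ∃ z : V, G.Adj w z ∧ G.Adj z u.1 ∧ G.Adj z v.1
    · obtain ⟨z, hwz, hzu, hzv⟩ := hz
      obtain ⟨x, hux, hxz⟩ := hreg.exists_adj_ne hΔ u.1 z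
      have hx : x ∈ {v : V | v ≠ w ∧ ¬ G.Adj w v} :=
        ⟨fun h => u.2.2 (h ▸ hux).symm,
          fun h => hxz (huniq u.2.1.symm h hux.symm hwz hzu)⟩
      have hstep : (G.induce {v : V | v ≠ w ∧ ¬ G.Adj w v}).Adj u ⟨x, hx⟩ := by simpa using hux
      obtain ⟨p, -⟩ := hshort ⟨x, hx⟩ v <| by
        rintro ⟨y, hwy, hyx, hyv⟩
        obtain rfl := huniq v.2.1.symm hwy hyv hwz hzv
        exact htri hzu hux hyx.symm
      exact hstep.reachable.trans p.reachable
    · obtain ⟨p, -⟩ := hshort u v hz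
      exact p.reachable
end

section
/- The Petersen graph has a proper distinguishing coloring with 4 colors; that is, χ_D(Petersen) ≤ 4. -/
/-- A coloring `φ` of the vertices of `G` is a proper distinguishing coloring if adjacent
vertices get different colors and the only automorphism of `G` preserving all colors is
the identity. -/
def IsProperDistinguishingColoring {V α : Type*} (G : SimpleGraph V) (φ : V → α) : Prop :=
  (∀ u v, G.Adj u v → φ u ≠ φ v) ∧
    ∀ f : G ≃g G, (∀ v, φ (f v) = φ v) → ∀ v, f v = v

/-- The Petersen graph: the Kneser graph `K(5,2)`, whose vertices are the 2-element
subsets of a 5-element set, with two vertices adjacent iff the subsets are disjoint. -/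
def petersenGraph : SimpleGraph {s : Finset (Fin 5) // s.card = 2} :=
  SimpleGraph.fromRel (fun a b => Disjoint a.1 b.1)

/-- A proper coloring in which every vertex is determined by its color together with the set
of colors of its neighbors is distinguishing. -/
theorem IsProperDistinguishingColoring.of_neighbor_colors {V α : Type*} {G : SimpleGraph V}
    {φ : V → α} (hφ : ∀ u v, G.Adj u v → φ u ≠ φ v)
    (h : ∀ u v, φ u = φ v → (∀ c, (∃ w, G.Adj u w ∧ φ w = c) ↔ ∃ w, G.Adj v w ∧ φ w = c) →
      u = v) :
    IsProperDistinguishingColoring G φ := by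
  refine ⟨hφ, fun f hf v => h _ _ (hf v) fun c => ⟨?_, ?_⟩⟩
  · rintro ⟨w, hw, rfl⟩
    refine ⟨f.symm w, f.map_adj_iff.1 (by simpa using hw), ?_⟩
    simpa using (hf (f.symm w)).symm
  · rintro ⟨w, hw, rfl⟩
    exact ⟨f w, f.map_adj_iff.2 hw, hf w⟩

instance : DecidableRel petersenGraph.Adj :=
  inferInstanceAs (DecidableRel (SimpleGraph.fromRel _).Adj)

/-- A 4-coloring of the Petersen graph whose first color class is the star at `0`. -/
def petersenColoring (s : {s : Finset (Fin 5) // s.card = 2}) : Fin 4 :=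
  if 0 ∈ s.1 then 0
  else if s.1 = {1, 2} ∨ s.1 = {1, 3} then 1
  else if s.1 = {1, 4} ∨ s.1 = {2, 4} then 2
  else 3

set_option synthInstance.maxSize 2000 in
/-- The Petersen graph has a proper distinguishing 4-coloring, i.e. `χ_D ≤ 4`. -/
theorem chiD_petersen_le_four :
    ∃ φ : {s : Finset (Fin 5) // s.card = 2} → Fin 4,
      IsProperDistinguishingColoring petersenGraph φ := by
  refine ⟨petersenColoring, .of_neighbor_colors ?_ ?_⟩
  · decide
  · decide
end
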